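/- Let n and m be positive integers and let G be a Whitney-maximum graph in C_{n,m}. Then for each k ∈ {1,…,n}, G is a k-uniformly most reliable graph: R_G^{(k)}(p) ≥ R_H^{(k)}(p) for every H ∈ C_{n,m} and every p ∈ [0,1]. -/

import Mathlib

open MvPolynomial

/-- Number of connected components of the spanning subgraph of a graph on `Fin n`
whose edge set is `s`. -/
noncomputable def ncomp (n : ℕ) (s : Set (Sym2 (Fin n))) : ℕ :=
  Nat.card (SimpleGraph.fromEdgeSet s).ConnectedComponent

/-- `G` is a member of `C_{n,m}`: a connected simple graph on `n` vertices and `m` edges. -/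
def IsCnm (n m : ℕ) (G : SimpleGraph (Fin n)) : Prop :=
  G.Connected ∧ G.edgeSet.ncard = m

/-- `N_i^{(k)}(G)`: the number of spanning subgraphs of `G` (identified with subsets of
`E(G)`) having exactly `i` edges and at most `k` connected components. -/
noncomputable def Ncnt (n : ℕ) (G : SimpleGraph (Fin n)) (i k : ℕ) : ℕ :=
  Set.ncard {s : Set (Sym2 (Fin n)) | s ⊆ G.edgeSet ∧ s.ncard = i ∧ ncomp n s ≤ k}

/-- `N_{i,j}(G)`: the number of spanning subgraphs of `G` having exactly `i` edges and
exactly `j` connected components. -/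
noncomputable def Nexact (n : ℕ) (G : SimpleGraph (Fin n)) (i j : ℕ) : ℕ :=
  Set.ncard {s : Set (Sym2 (Fin n)) | s ⊆ G.edgeSet ∧ s.ncard = i ∧ ncomp n s = j}

/-- The `k`-reliability of `G` at `p`: `R_G^{(k)}(p) = Σ_{i=0}^m N_i^{(k)}(G) p^i (1-p)^{m-i}`. -/
noncomputable def rel (n m : ℕ) (G : SimpleGraph (Fin n)) (k : ℕ) (p : ℝ) : ℝ :=
  ∑ i ∈ Finset.range (m + 1), (Ncnt n G i k : ℝ) * p ^ i * (1 - p) ^ (m - i)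

/-- The Tutte polynomial of `G`, `T_G(x,y) = Σ_{H ∈ S(G)} (x-1)^{r(G)-r(H)} (y-1)^{c(H)}`,
where the rank of the spanning subgraph with edge set `s` is `n - ncomp n s`, so that
`r(G) - r(H) = ncomp n s - ncomp n G.edgeSet`, and the corank is `s.ncard + ncomp n s - n`. -/
noncomputable def tutte (n : ℕ) (G : SimpleGraph (Fin n)) : MvPolynomial (Fin 2) ℝ :=
  ∑ᶠ s ∈ {t : Set (Sym2 (Fin n)) | t ⊆ G.edgeSet},
    (X 0 - 1) ^ (ncomp n s - ncomp n G.edgeSet) * (X 1 - 1) ^ (s.ncard + ncomp n s - n)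

/-- The Whitney polynomial of `G`, `W_G(x,y) = Σ_{H ∈ S(G)} x^{r(G)-r(H)} y^{c(H)}`. -/
noncomputable def whitney (n : ℕ) (G : SimpleGraph (Fin n)) : MvPolynomial (Fin 2) ℝ :=
  ∑ᶠ s ∈ {t : Set (Sym2 (Fin n)) | t ⊆ G.edgeSet},
    X 0 ^ (ncomp n s - ncomp n G.edgeSet) * X 1 ^ (s.ncard + ncomp n s - n)

/-- A bivariate polynomial is nonnegative if all its coefficients are nonnegative. -/
def NonnegPoly (P : MvPolynomial (Fin 2) ℝ) : Prop :=
  ∀ d : Fin 2 →₀ ℕ, 0 ≤ P.coeff d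

/-- `G` is Tutte-maximum in `C_{n,m}`. -/
def TutteMaximum (n m : ℕ) (G : SimpleGraph (Fin n)) : Prop :=
  ∀ H : SimpleGraph (Fin n), IsCnm n m H →
    ∃ P : MvPolynomial (Fin 2) ℝ, NonnegPoly P ∧
      tutte n G - tutte n H = (X 0 + X 1 - X 0 * X 1) * P

/-- `G` is Whitney-maximum in `C_{n,m}`. -/
def WhitneyMaximum (n m : ℕ) (G : SimpleGraph (Fin n)) : Prop :=
  ∀ H : SimpleGraph (Fin n), IsCnm n m H →
    ∃ Q : MvPolynomial (Fin 2) ℝ, NonnegPoly Q ∧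
      whitney n G - whitney n H = (1 - X 0 * X 1) * Q

/-- `G` is strong in `C_{n,m}`. -/
def Strong (n m : ℕ) (G : SimpleGraph (Fin n)) : Prop :=
  ∀ H : SimpleGraph (Fin n), IsCnm n m H →
    ∀ i ≤ m, ∀ k, 1 ≤ k → k ≤ n → Ncnt n H i k ≤ Ncnt n G i k

/-- `G` is a 0-element in `C_{n,m}`. -/
def ZeroElement (n m : ℕ) (G : SimpleGraph (Fin n)) : Prop :=
  ∀ H : SimpleGraph (Fin n), IsCnm n m H → ∀ i ≤ m, Ncnt n H i 1 ≤ Ncnt n G i 1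

/-- `t_k(G)`: the number of spanning forests of `G` composed of exactly `k` trees. -/
noncomputable def tcount (n : ℕ) (G : SimpleGraph (Fin n)) (k : ℕ) : ℕ :=
  Set.ncard {s : Set (Sym2 (Fin n)) |
    s ⊆ G.edgeSet ∧ (SimpleGraph.fromEdgeSet s).IsAcyclic ∧ ncomp n s = k}

/-- `λ^{(k)}(G)`: the minimum number of edges that must be removed from `G` to obtain a
spanning subgraph with more than `k` connected components. -/
noncomputable def lamk (n : ℕ) (G : SimpleGraph (Fin n)) (k : ℕ) : ℕ :=
  sInf {d : ℕ | ∃ D : Set (Sym2 (Fin n)),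
    D ⊆ G.edgeSet ∧ D.ncard = d ∧ k < ncomp n (G.edgeSet \ D)}

/-- `∂^{a+b} P / ∂x^a ∂y^b` evaluated at `(0,0)`. -/
noncomputable def pdevalXY (P : MvPolynomial (Fin 2) ℝ) (a b : ℕ) : ℝ :=
  MvPolynomial.eval (fun _ => (0 : ℝ))
    ((fun q => MvPolynomial.pderiv (0 : Fin 2) q)^[a]
      ((fun q => MvPolynomial.pderiv (1 : Fin 2) q)^[b] P))

/-- Reachability after adding one edge: a new connection runs through the added edge. -/
lemma SimpleGraph.Reachable.of_fromEdgeSet_insert {V : Type*} {s : Set (Sym2 V)} {u v x y : V}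
    (h : (SimpleGraph.fromEdgeSet (insert s(u, v) s)).Reachable x y) :
    (SimpleGraph.fromEdgeSet s).Reachable x y ∨
      (SimpleGraph.fromEdgeSet s).Reachable x v ∨ (SimpleGraph.fromEdgeSet s).Reachable v y := by
  suffices H : (SimpleGraph.fromEdgeSet s).Reachable x y ∨
      ((SimpleGraph.fromEdgeSet s).Reachable x v ∧ (SimpleGraph.fromEdgeSet s).Reachable u y) ∨
      ((SimpleGraph.fromEdgeSet s).Reachable x u ∧ (SimpleGraph.fromEdgeSet s).Reachable v y) by
    tauto
  obtain ⟨w⟩ := h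
  induction w with
  | nil => exact Or.inl (.refl _)
  | @cons a b c hab _ ih =>
    rw [SimpleGraph.fromEdgeSet_adj, Set.mem_insert_iff, Sym2.eq_iff] at hab
    obtain ⟨(⟨rfl, rfl⟩ | ⟨rfl, rfl⟩) | hs, hne⟩ := hab
    · rcases ih with h | ⟨-, h⟩ | ⟨-, h⟩
      · exact Or.inr (Or.inr ⟨.refl _, h⟩)
      · exact Or.inl h
      · exact Or.inr (Or.inr ⟨.refl _, h⟩)
    · rcases ih with h | ⟨-, h⟩ | ⟨-, h⟩
      · exact Or.inr (Or.inl ⟨.refl _, h⟩)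
      · exact Or.inr (Or.inl ⟨.refl _, h⟩)
      · exact Or.inl h
    · have hr : (SimpleGraph.fromEdgeSet s).Reachable a b :=
        SimpleGraph.Adj.reachable ((SimpleGraph.fromEdgeSet_adj s).2 ⟨hs, hne⟩)
      rcases ih with h | ⟨h₁, h₂⟩ | ⟨h₁, h₂⟩
      · exact Or.inl (hr.trans h)
      · exact Or.inr (Or.inl ⟨hr.trans h₁, h₂⟩)
      · exact Or.inr (Or.inr ⟨hr.trans h₁, h₂⟩)

lemma ncomp_le_ncomp_insert_add_one (n : ℕ) (e : Sym2 (Fin n)) (s : Set (Sym2 (Fin n))) :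
    ncomp n s ≤ ncomp n (insert e s) + 1 := by
  classical
  induction e with | h u v
  have hle : SimpleGraph.fromEdgeSet s ≤ SimpleGraph.fromEdgeSet (insert s(u, v) s) :=
    SimpleGraph.fromEdgeSet_mono (Set.subset_insert _ _)
  rw [ncomp, ncomp, ← Finite.card_option]
  refine Nat.card_le_card_of_injective
    (fun c => if c = (SimpleGraph.fromEdgeSet s).connectedComponentMk v then none
      else some (c.map (SimpleGraph.Hom.ofLE hle))) ?_
  intro c d hcd
  induction c using SimpleGraph.ConnectedComponent.ind with | h x
  induction d using SimpleGraph.ConnectedComponent.ind with | h y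
  simp only [SimpleGraph.ConnectedComponent.eq, SimpleGraph.ConnectedComponent.map_mk,
    SimpleGraph.Hom.coe_ofLE, id] at hcd ⊢
  split_ifs at hcd with hx hy hy
  · exact hx.trans hy.symm
  · rw [Option.some_inj, SimpleGraph.ConnectedComponent.eq] at hcd
    rcases hcd.of_fromEdgeSet_insert with h | h | h
    · exact h
    · exact absurd h hx
    · exact absurd h.symm hy

lemma le_ncard_add_ncomp (n : ℕ) (s : Set (Sym2 (Fin n))) : n ≤ s.ncard + ncomp n s := by
  induction s, s.toFinite using Set.Finite.induction_on with
  | empty =>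
    have hinj : Function.Injective
        (SimpleGraph.fromEdgeSet (∅ : Set (Sym2 (Fin n)))).connectedComponentMk := by
      intro x y h
      simpa using h
    simpa [ncomp] using Nat.card_le_card_of_injective _ hinj
  | @insert e s he hs ih =>
    rw [Set.ncard_insert_of_notMem he hs]
    have := ncomp_le_ncomp_insert_add_one n e s
    omega

lemma ncomp_pos {n : ℕ} (hn : 0 < n) (s : Set (Sym2 (Fin n))) : 0 < ncomp n s := by
  have : Nonempty (Fin n) := ⟨⟨0, hn⟩⟩
  exact Nat.card_pos

lemma IsCnm.ncomp_edgeSet {n m : ℕ} {G : SimpleGraph (Fin n)} (hG : IsCnm n m G) :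
    ncomp n G.edgeSet = 1 := by
  rw [ncomp, SimpleGraph.fromEdgeSet_edgeSet, Nat.card_eq_one_iff_unique]
  have := hG.1.nonempty
  exact ⟨hG.1.preconnected.subsingleton_connectedComponent, inferInstance⟩

/-- The exponent vector of `x ^ a * y ^ b`. -/
noncomputable def bidegree (a b : ℕ) : Fin 2 →₀ ℕ :=
  Finsupp.single 0 a + Finsupp.single 1 b

lemma bidegree_inj {a b a' b' : ℕ} : bidegree a b = bidegree a' b' ↔ a = a' ∧ b = b' := by
  refine ⟨fun h => ⟨?_, ?_⟩, by rintro ⟨rfl, rfl⟩; rfl⟩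
  · simpa [bidegree] using DFunLike.congr_fun h 0
  · simpa [bidegree] using DFunLike.congr_fun h 1

lemma X_pow_mul_X_pow_eq_monomial (a b : ℕ) :
    (X 0 ^ a * X 1 ^ b : MvPolynomial (Fin 2) ℝ) = monomial (bidegree a b) 1 := by
  rw [X_pow_eq_monomial, X_pow_eq_monomial, monomial_mul, one_mul, bidegree]

lemma X_mul_X_eq_monomial :
    (X 0 * X 1 : MvPolynomial (Fin 2) ℝ) = monomial (bidegree 1 1) 1 := by
  simpa using X_pow_mul_X_pow_eq_monomial 1 1

lemma bidegree_succ_succ (a b : ℕ) : bidegree (a + 1) (b + 1) = bidegree 1 1 + bidegree a b := by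
  simp only [bidegree, Finsupp.single_add]
  abel

lemma coeff_one_sub_X_mul_X_mul_succ (Q : MvPolynomial (Fin 2) ℝ) (a b : ℕ) :
    ((1 - X 0 * X 1) * Q).coeff (bidegree (a + 1) (b + 1)) =
      Q.coeff (bidegree (a + 1) (b + 1)) - Q.coeff (bidegree a b) := by
  rw [sub_mul, one_mul, coeff_sub, X_mul_X_eq_monomial, bidegree_succ_succ, coeff_monomial_mul,
    one_mul]

lemma coeff_one_sub_X_mul_X_mul_boundary (Q : MvPolynomial (Fin 2) ℝ) {a b : ℕ}
    (h : a = 0 ∨ b = 0) :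
    ((1 - X 0 * X 1) * Q).coeff (bidegree a b) = Q.coeff (bidegree a b) := by
  rw [sub_mul, one_mul, coeff_sub, X_mul_X_eq_monomial, coeff_monomial_mul', if_neg, sub_zero]
  intro hle
  have h₀ := hle 0
  have h₁ := hle 1
  simp [bidegree] at h₀ h₁
  omega

/-- The coefficients of the Whitney polynomial of a connected graph count spanning subgraphs by
number of edges and components. -/
lemma coeff_whitney {n m : ℕ} (hn : 0 < n) {G : SimpleGraph (Fin n)} (hG : IsCnm n m G)
    {i a b : ℕ} (h : n + b = i + (a + 1)) :
    (whitney n G).coeff (bidegree a b) = Nexact n G i (a + 1) := by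
  classical
  have hfin : {t : Set (Sym2 (Fin n)) | t ⊆ G.edgeSet}.Finite := Set.toFinite _
  rw [whitney, finsum_mem_eq_finite_toFinset_sum _ hfin, coeff_sum, Nexact,
    Set.ncard_eq_toFinset_card _ (Set.toFinite _)]
  simp only [X_pow_mul_X_pow_eq_monomial, coeff_monomial, Finset.sum_boole]
  congr 2
  ext s
  have h₁ := ncomp_pos hn s
  have h₂ := le_ncard_add_ncomp n s
  simp only [Finset.mem_filter, Set.Finite.mem_toFinset, Set.mem_ofPred_eq, bidegree_inj,
    hG.ncomp_edgeSet]
  refine and_congr_right fun _ => ?_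
  omega

lemma Ncnt_zero {n : ℕ} (hn : 0 < n) (G : SimpleGraph (Fin n)) (i : ℕ) : Ncnt n G i 0 = 0 := by
  rw [Ncnt, Set.ncard_eq_zero (Set.toFinite _), Set.eq_empty_iff_forall_notMem]
  rintro s ⟨-, -, h⟩
  have := ncomp_pos hn s
  omega

lemma Ncnt_eq_zero_of_add_lt {n : ℕ} (G : SimpleGraph (Fin n)) {i k : ℕ} (h : i + k < n) :
    Ncnt n G i k = 0 := by
  rw [Ncnt, Set.ncard_eq_zero (Set.toFinite _), Set.eq_empty_iff_forall_notMem]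
  rintro s ⟨-, hi, hk⟩
  have := le_ncard_add_ncomp n s
  omega

lemma Ncnt_succ (n : ℕ) (G : SimpleGraph (Fin n)) (i k : ℕ) :
    Ncnt n G i (k + 1) = Ncnt n G i k + Nexact n G i (k + 1) := by
  rw [Ncnt, Ncnt, Nexact, ← Set.ncard_union_eq _ (Set.toFinite _) (Set.toFinite _)]
  · congr 1
    ext s
    simp only [Set.mem_union, Set.mem_ofPred_eq, ← and_or_left, Nat.le_succ_iff]
  · rw [Set.disjoint_left]
    rintro s ⟨-, -, h⟩ ⟨-, -, h'⟩
    omega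

/-- The coefficients of the quotient `(W_G - W_H) / (1 - x y)` are the differences of the numbers
of spanning subgraphs with a given number of edges and a bounded number of components. -/
lemma Ncnt_sub_Ncnt_eq_coeff {n m : ℕ} (hn : 0 < n) {G H : SimpleGraph (Fin n)}
    (hG : IsCnm n m G) (hH : IsCnm n m H) {Q : MvPolynomial (Fin 2) ℝ}
    (hQ : whitney n G - whitney n H = (1 - X 0 * X 1) * Q) (i : ℕ) :
    ∀ a b : ℕ, n + b = i + (a + 1) →
      (Ncnt n G i (a + 1) : ℝ) - Ncnt n H i (a + 1) = Q.coeff (bidegree a b) := by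
  have hstep : ∀ a b : ℕ, n + b = i + (a + 1) →
      (Nexact n G i (a + 1) : ℝ) - Nexact n H i (a + 1) =
        ((1 - X 0 * X 1) * Q).coeff (bidegree a b) := by
    intro a b h
    rw [← coeff_whitney hn hG h, ← coeff_whitney hn hH h, ← coeff_sub, hQ]
  intro a
  induction a with
  | zero =>
    intro b h
    rw [Ncnt_succ, Ncnt_succ n H, Ncnt_zero hn, Ncnt_zero hn, Nat.zero_add (Nexact n G _ _),
      Nat.zero_add (Nexact n H _ _), hstep 0 b h,
      coeff_one_sub_X_mul_X_mul_boundary Q (Or.inl rfl)]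
  | succ a ih =>
    intro b h
    have hs := hstep (a + 1) b h
    rw [Ncnt_succ, Ncnt_succ n H]
    cases b with
    | zero =>
      rw [coeff_one_sub_X_mul_X_mul_boundary Q (Or.inr rfl)] at hs
      rw [Ncnt_eq_zero_of_add_lt G (by omega), Ncnt_eq_zero_of_add_lt H (by omega), zero_add,
        zero_add, hs]
    | succ b =>
      rw [coeff_one_sub_X_mul_X_mul_succ] at hs
      have := ih b (by omega)
      push_cast
      linarith

lemma WhitneyMaximum.Ncnt_le {n m : ℕ} (hn : 0 < n) {G H : SimpleGraph (Fin n)}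
    (hW : WhitneyMaximum n m G) (hG : IsCnm n m G) (hH : IsCnm n m H) (i k : ℕ) :
    Ncnt n H i k ≤ Ncnt n G i k := by
  obtain ⟨Q, hQ₀, hQ⟩ := hW H hH
  rcases lt_or_ge (i + k) n with h | h
  · simp [Ncnt_eq_zero_of_add_lt _ h]
  · cases k with
    | zero => simp [Ncnt_zero hn]
    | succ a =>
      have := Ncnt_sub_Ncnt_eq_coeff hn hG hH hQ i a (i + (a + 1) - n) (by omega)
      have h₀ := hQ₀ (bidegree a (i + (a + 1) - n))
      rw [← this, sub_nonneg] at h₀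
      exact_mod_cast h₀

/-- each Whitney-maximum graph in `C_{n,m}` is `k`-uniformly most
reliable for every `k ∈ {1,…,n}`. -/
theorem stmt16 (n m : ℕ) (hn : 0 < n) (hm : 0 < m) (G : SimpleGraph (Fin n))
    (hG : IsCnm n m G) (hW : WhitneyMaximum n m G) :
    ∀ k, 1 ≤ k → k ≤ n → ∀ H : SimpleGraph (Fin n), IsCnm n m H →
      ∀ p ∈ Set.Icc (0 : ℝ) 1, rel n m H k p ≤ rel n m G k p := by
  intro k _ _ H hH p hp
  refine Finset.sum_le_sum fun i _ => ?_
  have hp₀ := hp.1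
  have hp₁ : 0 ≤ 1 - p := sub_nonneg.2 hp.2
  have hle : (Ncnt n H i k : ℝ) ≤ Ncnt n G i k := by
    exact_mod_cast hW.Ncnt_le hn hG hH i k
  gcongr
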